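/- Let (Ω,T) be a minimal subshift over a finite alphabet. Then (Ω,T) satisfies Boshernitzan's condition (B) if and only if it satisfies condition (B'). -/

import Mathlib

open Filter MeasureTheory Set

noncomputable section

/-- `SL(2,ℝ)`. -/
abbrev SL2 : Type := Matrix.SpecialLinearGroup (Fin 2) ℝ

/-- The left shift on two-sided sequences. -/
def shift (𝒜 : Type*) : (ℤ → 𝒜) → ℤ → 𝒜 := fun ω n => ω (n + 1)

/-- A subshift: a closed, shift-invariant set of two-sided sequences. -/
def IsSubshift {𝒜 : Type*} [TopologicalSpace 𝒜] (Ω : Set (ℤ → 𝒜)) : Prop :=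
  IsClosed Ω ∧ shift 𝒜 '' Ω = Ω

/-- A minimal subshift: every two-sided orbit is dense. -/
def IsMinimalSubshift {𝒜 : Type*} [TopologicalSpace 𝒜] (Ω : Set (ℤ → 𝒜)) : Prop :=
  IsSubshift Ω ∧ ∀ ω ∈ Ω, Ω ⊆ closure (Set.range fun k : ℤ => fun n : ℤ => ω (n + k))

/-- An aperiodic subshift: no nontrivial shift fixes a point of `Ω`. -/
def IsAperiodicSubshift {𝒜 : Type*} (Ω : Set (ℤ → 𝒜)) : Prop :=
  ∀ ω ∈ Ω, ∀ n : ℤ, n ≠ 0 → (fun m => ω (m + n)) ≠ ω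

/-- The word `w` occurs in `ω` starting at position `k`. -/
def OccursAt {𝒜 : Type*} (ω : ℤ → 𝒜) (w : List 𝒜) (k : ℤ) : Prop :=
  ∀ i : Fin w.length, ω (k + i) = w.get i

/-- `w` belongs to `𝒲(Ω)`, the set of finite words of the subshift `Ω`. -/
def IsWordOf {𝒜 : Type*} (Ω : Set (ℤ → 𝒜)) (w : List 𝒜) : Prop :=
  ∃ ω ∈ Ω, ∃ k : ℤ, OccursAt ω w k

/-- `V_w = {ω ∈ Ω : ω(1)⋯ω(|w|) = w}`. -/
def Vset {𝒜 : Type*} (Ω : Set (ℤ → 𝒜)) (w : List 𝒜) : Set (ℤ → 𝒜) :=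
  {ω ∈ Ω | OccursAt ω w 1}

/-- `U_w = {ω ∈ Ω : w occurs in ω around position one}`. -/
def Uset {𝒜 : Type*} (Ω : Set (ℤ → 𝒜)) (w : List 𝒜) : Set (ℤ → 𝒜) :=
  {ω ∈ Ω | ∃ n : ℕ, n < w.length ∧ OccursAt ω w (1 - n)}

/-- Boshernitzan's condition (B): there are an ergodic probability measure `ν` (concentrated
on `Ω`), a constant `C > 0` and lengths `l n → ∞` with `|w| ν(V_w) ≥ C` whenever `|w| = l n`;
equivalently `limsup n η_ν(n) > 0`. -/
def CondB {𝒜 : Type*} [MeasurableSpace 𝒜] (Ω : Set (ℤ → 𝒜)) : Prop :=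
  ∃ ν : Measure (ℤ → 𝒜), IsProbabilityMeasure ν ∧ ν Ωᶜ = 0 ∧ Ergodic (shift 𝒜) ν ∧
    ∃ C > (0 : ℝ), ∃ l : ℕ → ℕ, Tendsto l atTop atTop ∧
      ∀ n : ℕ, ∀ w : List 𝒜, IsWordOf Ω w → w.length = l n →
        C ≤ (w.length : ℝ) * (ν (Vset Ω w)).toReal

/-- Condition (B'): there are an ergodic probability measure `ν` (concentrated on `Ω`),
a constant `C' > 0` and lengths `l n → ∞` with `ν(U_w) ≥ C'` whenever `|w| = l n`. -/
def CondB' {𝒜 : Type*} [MeasurableSpace 𝒜] (Ω : Set (ℤ → 𝒜)) : Prop :=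
  ∃ ν : Measure (ℤ → 𝒜), IsProbabilityMeasure ν ∧ ν Ωᶜ = 0 ∧ Ergodic (shift 𝒜) ν ∧
    ∃ C > (0 : ℝ), ∃ l : ℕ → ℕ, Tendsto l atTop atTop ∧
      ∀ n : ℕ, ∀ w : List 𝒜, IsWordOf Ω w → w.length = l n →
        C ≤ (ν (Uset Ω w)).toReal

/-- Unique ergodicity: there is exactly one shift-invariant Borel probability measure
concentrated on `Ω`. -/
def UniquelyErgodicSubshift {𝒜 : Type*} [MeasurableSpace 𝒜] (Ω : Set (ℤ → 𝒜)) : Prop :=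
  ∃! ν : Measure (ℤ → 𝒜),
    IsProbabilityMeasure ν ∧ ν Ωᶜ = 0 ∧ MeasurePreserving (shift 𝒜) ν ν

/-- A function on sequences is locally constant (on `Ω`) if its value only depends on
the coordinates `ω(−N)⋯ω(N)` for some `N`. -/
def LocConstOn {𝒜 β : Type*} (Ω : Set (ℤ → 𝒜)) (A : (ℤ → 𝒜) → β) : Prop :=
  ∃ N : ℕ, ∀ ω ∈ Ω, ∀ ρ ∈ Ω, (∀ i : ℤ, |i| ≤ (N : ℤ) → ω i = ρ i) → A ω = A ρ

/-- The cocycle `A(n,ω) = A(T^{n−1}ω)⋯A(ω)`. -/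
def cocycle {𝒜 G : Type*} [Monoid G] (A : (ℤ → 𝒜) → G) : ℕ → (ℤ → 𝒜) → G
  | 0, _ => 1
  | n + 1, ω => A ((shift 𝒜)^[n] ω) * cocycle A n ω

/-- A concrete norm on 2×2 real matrices (the Frobenius norm). -/
def matNorm (M : Matrix (Fin 2) (Fin 2) ℝ) : ℝ :=
  Real.sqrt (∑ i : Fin 2, ∑ j : Fin 2, (M i j) ^ 2)

/-- `A : Ω → SL(2,ℝ)` is uniform: `(1/n) log‖A(n,ω)‖` converges, uniformly on `Ω`,
to a constant `Λ(A)`. -/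
def IsUniformOn {𝒜 : Type*} (Ω : Set (ℤ → 𝒜)) (A : (ℤ → 𝒜) → SL2) : Prop :=
  ∃ Λ : ℝ, TendstoUniformlyOn
    (fun (n : ℕ) (ω : ℤ → 𝒜) =>
      (n : ℝ)⁻¹ * Real.log (matNorm ((cocycle A n ω : SL2) : Matrix (Fin 2) (Fin 2) ℝ)))
    (fun _ => Λ) atTop Ω

/-- Property (P): every locally constant `SL(2,ℝ)`-valued function on `Ω` is uniform. -/
def PropP {𝒜 : Type*} (Ω : Set (ℤ → 𝒜)) : Prop :=
  ∀ A : (ℤ → 𝒜) → SL2, LocConstOn Ω A → IsUniformOn Ω A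

/-- The word `ω(1)⋯ω(n)`. -/
def wordOf {𝒜 : Type*} (ω : ℤ → 𝒜) (n : ℕ) : List 𝒜 :=
  (List.range n).map fun i => ω (1 + i)

/-- A subadditive function on the words of `Ω`. -/
def SubadditiveOn {𝒜 : Type*} (Ω : Set (ℤ → 𝒜)) (F : List 𝒜 → ℝ) : Prop :=
  ∀ x y : List 𝒜, IsWordOf Ω x → IsWordOf Ω y → IsWordOf Ω (x ++ y) →
    F (x ++ y) ≤ F x + F y

/-- The complexity function `p(n) = #{w ∈ 𝒲(Ω) : |w| = n}`. -/
def complexity {𝒜 : Type*} (Ω : Set (ℤ → 𝒜)) (n : ℕ) : ℕ :=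
  Set.ncard {w : List 𝒜 | IsWordOf Ω w ∧ w.length = n}

/-- A right-special word. -/
def RightSpecial {𝒜 : Type*} (Ω : Set (ℤ → 𝒜)) (w : List 𝒜) : Prop :=
  ∃ a b : 𝒜, a ≠ b ∧ IsWordOf Ω (w ++ [a]) ∧ IsWordOf Ω (w ++ [b])

/-- A left-special word. -/
def LeftSpecial {𝒜 : Type*} (Ω : Set (ℤ → 𝒜)) (w : List 𝒜) : Prop :=
  ∃ a b : 𝒜, a ≠ b ∧ IsWordOf Ω (a :: w) ∧ IsWordOf Ω (b :: w)

/-- `σ ∈ ℬ^ℤ` is the image of `ω ∈ 𝒜^ℤ` under the substitution `S`, with `S(ω(0))`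
starting at position `0`. -/
def IsSubstImage {𝒜 ℬ : Type*} (S : 𝒜 → List ℬ) (ω : ℤ → 𝒜) (σ : ℤ → ℬ) : Prop :=
  ∃ c : ℤ → ℤ, c 0 = 0 ∧ (∀ k : ℤ, c (k + 1) = c k + (S (ω k)).length) ∧
    ∀ k : ℤ, ∀ j : Fin (S (ω k)).length, σ (c k + j) = (S (ω k)).get j

/-- `Ω(S) = {T^k S(ω) : ω ∈ Ω, k ∈ ℤ}`. -/
def SubstSubshift {𝒜 ℬ : Type*} (S : 𝒜 → List ℬ) (Ω : Set (ℤ → 𝒜)) : Set (ℤ → ℬ) :=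
  {τ | ∃ ω ∈ Ω, ∃ σ : ℤ → ℬ, IsSubstImage S ω σ ∧ ∃ k : ℤ, τ = fun n => σ (n + k)}

/-- `S` is recognizable with respect to `(Ω,T)`: there is a locally constant
`S̃ : Ω(S) → Ω × ℤ` with `S̃(T^k S(ω)) = (ω,k)` for `0 ≤ k ≤ |S(ω(0))|`. -/
def Recognizable {𝒜 ℬ : Type*} (S : 𝒜 → List ℬ) (Ω : Set (ℤ → 𝒜)) : Prop :=
  ∃ St : (ℤ → ℬ) → (ℤ → 𝒜) × ℤ, LocConstOn (SubstSubshift S Ω) St ∧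
    ∀ ω ∈ Ω, ∀ σ : ℤ → ℬ, IsSubstImage S ω σ →
      ∀ k : ℕ, k ≤ (S (ω 0)).length → St (fun n => σ (n + k)) = (ω, (k : ℤ))

/-- A Cantor set: compact, empty interior, no isolated points. -/
def IsCantorSet (S : Set ℝ) : Prop :=
  IsCompact S ∧ interior S = ∅ ∧ ∀ x ∈ S, AccPt x (Filter.principal S)

/-- `H` is the Schrödinger operator on `ℓ²(ℤ)` with potential `V`:
`(Hu)(n) = u(n+1) + u(n−1) + V(n)u(n)`. -/
def IsSchrodingerOp (V : ℤ → ℝ)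
    (H : lp (fun _ : ℤ => ℝ) 2 →L[ℝ] lp (fun _ : ℤ => ℝ) 2) : Prop :=
  ∀ u : lp (fun _ : ℤ => ℝ) 2, ∀ n : ℤ,
    (H u : ∀ _ : ℤ, ℝ) n = (u : ∀ _ : ℤ, ℝ) (n + 1) + (u : ∀ _ : ℤ, ℝ) (n - 1)
      + V n * (u : ∀ _ : ℤ, ℝ) n

/-- The circle map potential `V_{α,β,θ}(n) = χ_{[1−β,1)}(nα + θ mod 1)`. -/
def circleV (α β θ : ℝ) : ℤ → ℝ := fun n =>
  (Set.Ico (1 - β) 1).indicator (fun _ => (1 : ℝ)) (Int.fract (n * α + θ))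

/-- The coding `v_n(α,β,θ) = χ_{[0,β)}(nα + θ mod 1)` of the rotation by `α`. -/
def circleSeq (α β θ : ℝ) : ℤ → Bool := fun n =>
  if Int.fract (n * α + θ) < β then true else false

/-- The circle map subshift `Ω_{α,β}`. -/
def circleSubshift (α β : ℝ) : Set (ℤ → Bool) :=
  closure {ω | ∃ θ : ℝ, 0 ≤ θ ∧ θ < 1 ∧ ω = circleSeq α β θ}

/-- The one-step transfer matrix `M^E(ω)`. -/
def transferMat (E : ℝ) (ω : ℤ → ℝ) : Matrix (Fin 2) (Fin 2) ℝ :=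
  !![E - ω 1, -1; 1, 0]

/-- The Lyapunov exponent `γ(E) = inf_{n ≥ 1} (1/n) ∫ log‖M^E(n,ω)‖ dμ(ω)`. -/
def lyapunov (μ : Measure (ℤ → ℝ)) (E : ℝ) : ℝ :=
  ⨅ n : ℕ+, ((n : ℕ) : ℝ)⁻¹ *
    ∫ ω, Real.log (matNorm (cocycle (transferMat E) (n : ℕ) ω)) ∂μ

end

section Words

variable {𝒜 : Type*}

theorem occursAt_iff {ω : ℤ → 𝒜} {w : List 𝒜} {k : ℤ} :
    OccursAt ω w k ↔ ∀ (i : ℕ) (h : i < w.length), ω (k + i) = w[i] :=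
  ⟨fun H i h => H ⟨i, h⟩, fun H i => H i i.2⟩

/-- The word of length `l` that `ω` has at position `k`. -/
def factor (ω : ℤ → 𝒜) (k : ℤ) (l : ℕ) : List 𝒜 :=
  List.ofFn fun i : Fin l => ω (k + i)

@[simp] theorem length_factor (ω : ℤ → 𝒜) (k : ℤ) (l : ℕ) : (factor ω k l).length = l := by
  simp [factor]

theorem occursAt_factor_iff {ω σ : ℤ → 𝒜} {k m : ℤ} {l : ℕ} :
    OccursAt σ (factor ω k l) m ↔ ∀ i : ℕ, i < l → σ (m + i) = ω (k + i) := by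
  simp [occursAt_iff, factor]

theorem isWordOf_factor {Ω : Set (ℤ → 𝒜)} {ω : ℤ → 𝒜} (hω : ω ∈ Ω) (k : ℤ) (l : ℕ) :
    IsWordOf Ω (factor ω k l) :=
  ⟨ω, hω, k, occursAt_factor_iff.2 fun _ _ => rfl⟩

/-- Where a factor of `ω` occurs, all words inside it occur at the same relative positions. -/
theorem OccursAt.of_factor {ω σ : ℤ → 𝒜} {k m : ℤ} {l j : ℕ} {v : List 𝒜}
    (h : OccursAt σ (factor ω k l) m) (hj : j + v.length ≤ l) :
    OccursAt σ v (m + j) ↔ OccursAt ω v (k + j) := by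
  rw [occursAt_factor_iff] at h
  simp only [occursAt_iff]
  refine forall₂_congr fun i hi => ?_
  have := h (j + i) (by omega)
  push_cast at this
  rw [add_assoc, add_assoc, this]

theorem shift_iterate_apply (ω : ℤ → 𝒜) (n : ℕ) (m : ℤ) :
    (shift 𝒜)^[n] ω m = ω (m + n) := by
  induction n generalizing m with
  | zero => simp
  | succ n ih =>
    rw [Function.iterate_succ_apply', shift, ih]
    congr 1
    push_cast
    ring

theorem occursAt_shift_iterate {ω : ℤ → 𝒜} {w : List 𝒜} {k : ℤ} (n : ℕ) :
    OccursAt ((shift 𝒜)^[n] ω) w k ↔ OccursAt ω w (k + n) := by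
  simp only [occursAt_iff, shift_iterate_apply, add_right_comm]

theorem occursAt_shift {ω : ℤ → 𝒜} {w : List 𝒜} {k : ℤ} :
    OccursAt (shift 𝒜 ω) w k ↔ OccursAt ω w (k + 1) := by
  simpa using occursAt_shift_iterate (ω := ω) (w := w) (k := k) 1

/-- The cylinder of all sequences in which `w` occurs at position `k`. -/
def wordCylinder (w : List 𝒜) (k : ℤ) : Set (ℤ → 𝒜) := {ω | OccursAt ω w k}

theorem Vset_eq_inter (Ω : Set (ℤ → 𝒜)) (w : List 𝒜) : Vset Ω w = wordCylinder w 1 ∩ Ω := by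
  ext ω
  simp [Vset, wordCylinder, and_comm]

theorem Uset_eq_inter (Ω : Set (ℤ → 𝒜)) (w : List 𝒜) :
    Uset Ω w = (⋃ n ∈ Finset.range w.length, wordCylinder w (1 - n)) ∩ Ω := by
  ext ω
  simp [Uset, wordCylinder, and_comm]

theorem IsMinimalSubshift.exists_apply_eq [TopologicalSpace 𝒜] [DiscreteTopology 𝒜]
    {Ω : Set (ℤ → 𝒜)} (h : IsMinimalSubshift Ω) {ω ρ : ℤ → 𝒜} (hω : ω ∈ Ω) (hρ : ρ ∈ Ω)
    (k : ℤ) : ∃ m, ω m = ρ k := by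
  have hopen : IsOpen {x : ℤ → 𝒜 | x k = ρ k} :=
    (isOpen_discrete {ρ k}).preimage (f := fun x : ℤ → 𝒜 => x k) (continuous_apply k)
  obtain ⟨_, hx, m, rfl⟩ := mem_closure_iff.1 (h.2 ω hω hρ) _ hopen rfl
  exact ⟨k + m, hx⟩

end Words

section Measurability

variable {𝒜 : Type*} [MeasurableSpace 𝒜]

/-- A coordinatewise map which fixes every measurable set of letters fixes every measurable set
of sequences. -/
theorem preimage_comp_eq_of_measurableSet {ι : Type*} {f : 𝒜 → 𝒜}
    (hf : ∀ s, MeasurableSet s → f ⁻¹' s = s) {N : Set (ι → 𝒜)} (hN : MeasurableSet N) :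
    (fun x : ι → 𝒜 => f ∘ x) ⁻¹' N = N := by
  have hle : (MeasurableSpace.pi : MeasurableSpace (ι → 𝒜)) ≤
      MeasurableSpace.invariants fun x : ι → 𝒜 => f ∘ x := by
    refine iSup_le fun i => ?_
    rintro _ ⟨s, hs, rfl⟩
    refine MeasurableSpace.measurableSet_invariants.2 ⟨measurable_pi_apply i hs, ?_⟩
    change (fun x : ι → 𝒜 => x i) ⁻¹' (f ⁻¹' s) = _
    rw [hf s hs]
  exact (MeasurableSpace.measurableSet_invariants.1 (hle N hN)).2

/-- If a minimal subshift has full measure, every letter occurring in it is measurable. -/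
theorem IsMinimalSubshift.measurableSet_singleton [Finite 𝒜] [TopologicalSpace 𝒜]
    [DiscreteTopology 𝒜] {Ω : Set (ℤ → 𝒜)} (h : IsMinimalSubshift Ω) {ν : Measure (ℤ → 𝒜)}
    [IsProbabilityMeasure ν] (hν : ν Ωᶜ = 0) {ρ : ℤ → 𝒜} (hρ : ρ ∈ Ω) (k : ℤ) :
    MeasurableSet {ρ k} := by
  classical
  suffices H : measurableAtom (ρ k) = {ρ k} from
    H ▸ MeasurableSet.measurableAtom_of_countable (ρ k)
  refine Subset.antisymm (fun b hb => ?_) (by simp)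
  by_contra! hne
  rw [mem_singleton_iff] at hne
  let f : 𝒜 → 𝒜 := fun x => if x = ρ k then b else x
  have hf : ∀ s, MeasurableSet s → f ⁻¹' s = s := by
    intro s hs
    have hiff : b ∈ s ↔ ρ k ∈ s := by
      refine ⟨fun hbs => ?_, fun ha => measurableAtom_subset hs ha hb⟩
      by_contra ha
      exact measurableAtom_subset hs.compl ha hb hbs
    ext x
    by_cases hx : x = ρ k <;> simp [f, hx, hiff]
  obtain ⟨N, hΩN, hN, hN0⟩ := exists_measurable_superset_of_null hν
  obtain ⟨ω, hω⟩ : Nᶜ.Nonempty := by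
    rw [nonempty_compl]
    rintro rfl
    simp at hN0
  have hω' : f ∘ ω ∈ Ω := by
    by_contra hn
    have hmem : ω ∈ (fun x : ℤ → 𝒜 => f ∘ x) ⁻¹' N := hΩN hn
    rw [preimage_comp_eq_of_measurableSet hf hN] at hmem
    exact hω hmem
  obtain ⟨m, hm⟩ := h.exists_apply_eq hω' hρ k
  by_cases hx : ω m = ρ k
  · exact hne (by simpa [f, hx] using hm)
  · simp [f, hx] at hm

theorem measurableSet_wordCylinder {w : List 𝒜} (hw : ∀ a ∈ w, MeasurableSet {a}) (k : ℤ) :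
    MeasurableSet (wordCylinder w k) := by
  have : wordCylinder w k =
      ⋂ i : Fin w.length, (fun ω : ℤ → 𝒜 => ω (k + i)) ⁻¹' {w.get i} := by
    ext ω
    simp [wordCylinder, OccursAt]
  rw [this]
  exact MeasurableSet.iInter fun i =>
    measurable_pi_apply (k + (i : ℤ)) (hw _ (List.get_mem w i))

theorem IsMinimalSubshift.measurableSet_wordCylinder [Finite 𝒜] [TopologicalSpace 𝒜]
    [DiscreteTopology 𝒜] {Ω : Set (ℤ → 𝒜)} (h : IsMinimalSubshift Ω) {ν : Measure (ℤ → 𝒜)}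
    [IsProbabilityMeasure ν] (hν : ν Ωᶜ = 0) {w : List 𝒜} (hw : IsWordOf Ω w) (k : ℤ) :
    MeasurableSet (wordCylinder w k) := by
  refine _root_.measurableSet_wordCylinder (fun a ha => ?_) k
  obtain ⟨ρ, hρ, m, hocc⟩ := hw
  obtain ⟨i, hi, rfl⟩ := List.getElem_of_mem ha
  rw [← occursAt_iff.1 hocc i hi]
  exact h.measurableSet_singleton hν hρ _

theorem measure_wordCylinder_sub {ν : Measure (ℤ → 𝒜)} (hν : MeasurePreserving (shift 𝒜) ν ν)
    {w : List 𝒜} (hw : ∀ k, MeasurableSet (wordCylinder w k)) (k : ℤ) (n : ℕ) :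
    ν (wordCylinder w (k - n)) = ν (wordCylinder w k) := by
  rw [← (hν.iterate n).measure_preimage (hw (k - n)).nullMeasurableSet]
  congr 1
  ext ω
  simp [wordCylinder, occursAt_shift_iterate]

end Measurability

section Boshernitzan

variable {𝒜 : Type*} [Finite 𝒜] [TopologicalSpace 𝒜] [DiscreteTopology 𝒜] [MeasurableSpace 𝒜]
  {Ω : Set (ℤ → 𝒜)} {ν : Measure (ℤ → 𝒜)} [IsProbabilityMeasure ν]

theorem IsMinimalSubshift.measure_Uset_le (h : IsMinimalSubshift Ω) (hν : ν Ωᶜ = 0)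
    (hT : MeasurePreserving (shift 𝒜) ν ν) {w : List 𝒜} (hw : IsWordOf Ω w) :
    ν (Uset Ω w) ≤ w.length * ν (Vset Ω w) := by
  have hmeas := h.measurableSet_wordCylinder hν hw
  rw [Uset_eq_inter, Vset_eq_inter, measure_inter_conull hν, measure_inter_conull hν]
  refine (measure_biUnion_finset_le _ _).trans_eq ?_
  simp [measure_wordCylinder_sub hT hmeas]

/-- If after some occurrence of `v` the word `v` does not reappear within the next `|v|` places,
the extension `u` of `v` by these places satisfies `|v| ν(V_u) ≤ ν(U_v)`. -/
theorem IsMinimalSubshift.length_mul_measure_Vset_le (h : IsMinimalSubshift Ω) (hν : ν Ωᶜ = 0)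
    (hT : MeasurePreserving (shift 𝒜) ν ν) {v : List 𝒜} {l : ℕ} (hl : 2 * v.length ≤ l)
    {ω : ℤ → 𝒜} (hω : ω ∈ Ω) {k : ℤ} (hv : OccursAt ω v k)
    (hgap : ∀ i : ℕ, 1 ≤ i → i ≤ v.length → ¬ OccursAt ω v (k + i)) :
    v.length * ν (Vset Ω (factor ω k l)) ≤ ν (Uset Ω v) := by
  have hmeas := h.measurableSet_wordCylinder hν (isWordOf_factor hω k l)
  rw [Uset_eq_inter, Vset_eq_inter, measure_inter_conull hν, measure_inter_conull hν]
  calc v.length * ν (wordCylinder (factor ω k l) 1)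
      = ∑ n ∈ Finset.range v.length, ν (wordCylinder (factor ω k l) (1 - n)) := by
        simp [measure_wordCylinder_sub hT hmeas]
    _ = ν (⋃ n ∈ Finset.range v.length, wordCylinder (factor ω k l) (1 - n)) := by
        refine (measure_biUnion_finset ?_ fun n _ => hmeas _).symm
        have key : ∀ i j : ℕ, i < j → j < v.length →
            Disjoint (wordCylinder (factor ω k l) (1 - i))
              (wordCylinder (factor ω k l) (1 - j)) := by
          intro i j hij hj
          refine Set.disjoint_left.2 fun σ hi hj' => ?_
          have h1 : OccursAt σ v (1 - i) := by
            simpa using (OccursAt.of_factor (j := 0) hi (by omega)).2 (by simpa using hv)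
          refine hgap (j - i) (by omega) (by omega) ?_
          refine (OccursAt.of_factor (j := j - i) hj' (by omega)).1 ?_
          convert h1 using 1
          omega
        intro i hi j hj hij
        rw [Finset.mem_coe, Finset.mem_range] at hi hj
        rcases lt_or_gt_of_ne hij with hlt | hlt
        · exact key i j hlt hj
        · exact (key j i hlt hi).symm
    _ ≤ _ := by
        refine measure_mono (iUnion₂_mono fun n _ σ hσ => ?_)
        simpa [wordCylinder] using
          (OccursAt.of_factor (j := 0) (v := v) hσ (by omega)).2 (by simpa using hv)

/-- If every occurrence of `v` is followed by another one within the next `|v|` places and `U_v`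
is not null, then `U_v` has full measure. -/
theorem IsMinimalSubshift.measure_Uset_eq_one (h : IsMinimalSubshift Ω) (hν : ν Ωᶜ = 0)
    (hT : Ergodic (shift 𝒜) ν) {v : List 𝒜} (hw : IsWordOf Ω v)
    (hrec : ∀ ω ∈ Ω, ∀ k, OccursAt ω v k → ∃ i : ℕ, 1 ≤ i ∧ i ≤ v.length ∧ OccursAt ω v (k + i))
    (hpos : ν (Uset Ω v) ≠ 0) : ν (Uset Ω v) = 1 := by
  have hmeas := h.measurableSet_wordCylinder hν hw
  rw [Uset_eq_inter, measure_inter_conull hν] at *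
  set W := ⋃ n ∈ Finset.range v.length, wordCylinder v (1 - (n : ℤ)) with hW
  have hWm : MeasurableSet W := Finset.measurableSet_biUnion _ fun n _ => hmeas _
  have hmem : ∀ σ, σ ∈ W ↔ ∃ n : ℕ, n < v.length ∧ OccursAt σ v (1 - n) := by
    simp [hW, wordCylinder]
  have hsub : W ≤ᵐ[ν] shift 𝒜 ⁻¹' W := by
    filter_upwards [mem_ae_iff.2 hν] with ω hω hωW
    obtain ⟨n, hn, hocc⟩ := (hmem ω).1 hωW
    refine (hmem _).2 ?_
    simp only [occursAt_shift]
    by_cases hlt : n + 1 < v.length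
    · exact ⟨n + 1, hlt, by convert hocc using 1; push_cast; ring⟩
    · obtain ⟨i, hi, hiv, hocc'⟩ := hrec ω hω _ hocc
      exact ⟨n + 1 - i, by omega, by convert hocc' using 1; omega⟩
  rcases hT.ae_empty_or_univ_of_ae_le_preimage hWm.nullMeasurableSet hsub with h0 | h1
  · exact absurd (by simpa using measure_congr h0) hpos
  · simpa using measure_congr h1

theorem CondB'.condB (h : IsMinimalSubshift Ω) (hB : CondB' Ω) : CondB Ω := by
  obtain ⟨ν, hprob, hν, hT, C, hC, l, hl, H⟩ := hB
  refine ⟨ν, hprob, hν, hT, C, hC, l, hl, fun n w hw hwl => (H n w hw hwl).trans ?_⟩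
  simpa using ENNReal.toReal_mono (ENNReal.mul_ne_top (by simp) (measure_ne_top _ _))
    (h.measure_Uset_le hν hT.toMeasurePreserving hw)

theorem CondB.condB' (h : IsMinimalSubshift Ω) (hB : CondB Ω) : CondB' Ω := by
  obtain ⟨ν, hprob, hν, hT, C, hC, l, hl, H⟩ := hB
  obtain ⟨N, hN⟩ := eventually_atTop.1 (hl.eventually_ge_atTop 2)
  refine ⟨ν, hprob, hν, hT, min 1 (C / 3), by positivity, fun n => l (n + N) / 2,
    (Nat.tendsto_div_const_atTop two_ne_zero).comp (hl.comp (tendsto_add_atTop_nat N)), ?_⟩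
  intro n v hv hvl
  dsimp only at hvl
  have hl2 : 2 ≤ l (n + N) := hN _ (by omega)
  by_cases hrec : ∀ ω ∈ Ω, ∀ k, OccursAt ω v k →
      ∃ i : ℕ, 1 ≤ i ∧ i ≤ v.length ∧ OccursAt ω v (k + i)
  · refine (min_le_left _ _).trans_eq ?_
    rw [h.measure_Uset_eq_one hν hT hv hrec, ENNReal.toReal_one]
    intro h0
    obtain ⟨ω, hω, k, hocc⟩ := hv
    have hsub : Vset Ω (factor ω k (l (n + N))) ⊆ Uset Ω v := fun σ hσ =>
      ⟨hσ.1, 0, by omega, by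
        simpa using (OccursAt.of_factor (j := 0) (v := v) hσ.2 (by omega)).2 (by simpa using hocc)⟩
    have := H (n + N) _ (isWordOf_factor hω k _) (length_factor _ _ _)
    rw [measure_mono_null hsub h0] at this
    simp at this
    linarith
  · push Not at hrec
    obtain ⟨ω, hω, k, hocc, hgap⟩ := hrec
    refine (min_le_right _ _).trans ?_
    have hB := H (n + N) _ (isWordOf_factor hω k _) (length_factor _ _ _)
    have hle := ENNReal.toReal_mono (measure_ne_top _ _)
      (h.length_mul_measure_Vset_le hν hT.toMeasurePreserving (l := l (n + N)) (by omega)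
        hω hocc hgap)
    rw [ENNReal.toReal_mul, ENNReal.toReal_natCast] at hle
    rw [length_factor] at hB
    have h3 : (l (n + N) : ℝ) ≤ 3 * v.length := by
      exact_mod_cast (by omega : l (n + N) ≤ 3 * v.length)
    nlinarith [mul_le_mul_of_nonneg_right h3
      (ENNReal.toReal_nonneg (a := ν (Vset Ω (factor ω k (l (n + N))))))]

end Boshernitzan

/-- for minimal subshifts, condition (B) holds iff condition (B') holds. -/
theorem stmt5 {𝒜 : Type*} [Fintype 𝒜] [TopologicalSpace 𝒜] [DiscreteTopology 𝒜]
    [MeasurableSpace 𝒜] (Ω : Set (ℤ → 𝒜)) (hmin : IsMinimalSubshift Ω) :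
    CondB Ω ↔ CondB' Ω :=
  ⟨CondB.condB' hmin, CondB'.condB hmin⟩
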